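/- arXiv:math/0302026 — 2 statements merged into one kernel-verified Lean document; each statement's English description precedes it below -/
import Mathlib

section
/- Let Λ = ℤ[t, t⁻¹] and k ≥ 1. Every exact sequence of Λ-modules Λ^r → Λ^g → (Λ/⟨3, t+1⟩)^k → 0 satisfies g − r ≤ −k; that is, the deficiency of the Λ-module (Λ/⟨3, t+1⟩)^k is at most −k. -/
open LaurentPolynomial

/-- `Λ = ℤ[t, t⁻¹]`, the ring of Laurent polynomials over `ℤ`. -/
abbrev Λ : Type := LaurentPolynomial ℤ

/-- The ideal `⟨3, t+1⟩` of `Λ`. -/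
noncomputable abbrev I : Ideal Λ := Ideal.span {(3 : Λ), T 1 + 1}

/-- A linear map from `R^n` to an `R ⧸ J`-module descends to `(R ⧸ J)^n`. -/
lemma exists_descend_quotient {R : Type*} [CommRing R] (J : Ideal R) {n : ℕ} {N : Type*}
    [AddCommGroup N] [Module R N] [Module (R ⧸ J) N] [IsScalarTower R (R ⧸ J) N]
    (q : (Fin n → R) →ₗ[R] N) :
    ∃ q' : (Fin n → R ⧸ J) →ₗ[R ⧸ J] N,
      ∀ u, q' (fun i => Ideal.Quotient.mk J (u i)) = q u := by
  refine ⟨Fintype.linearCombination (R ⧸ J) fun i => q (Pi.single i 1), fun u => ?_⟩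
  rw [Fintype.linearCombination_apply, q.pi_apply_eq_sum_univ u]
  refine Finset.sum_congr rfl fun i _ => ?_
  have single_eq : (Pi.single i 1 : Fin n → R) = fun j => if i = j then 1 else 0 := by
    ext j
    simp [Pi.single_apply, eq_comm]
  rw [single_eq, ← Ideal.Quotient.algebraMap_eq, algebraMap_smul]

/-- For a maximal ideal `m`, a presentation of `(R ⧸ m)^k` with `g` generators and `r` relations
satisfies `g + k * dim (m / m²) ≤ r + k`. -/
lemma add_mul_finrank_cotangent_le {R : Type*} [CommRing R] (m : Ideal R) [m.IsMaximal]
    [Module.Finite (R ⧸ m) m.Cotangent] {k g r : ℕ}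
    (f : (Fin r → R) →ₗ[R] (Fin g → R))
    (p : (Fin g → R) →ₗ[R] (Fin k → R ⧸ m))
    (hp : Function.Surjective p) (hexact : LinearMap.range f = LinearMap.ker p) :
    g + k * Module.finrank (R ⧸ m) m.Cotangent ≤ r + k := by
  let _ : Field (R ⧸ m) := Ideal.Quotient.field m
  have hpf (u) : p (f u) = 0 := by
    rw [← LinearMap.mem_ker, ← hexact]
    exact LinearMap.mem_range_self f u
  obtain ⟨P, hP⟩ := Module.projective_lifting_property
    (LinearMap.compLeft (Submodule.mkQ m) (Fin k)) p
    (Function.Surjective.comp_left (Submodule.mkQ_surjective m))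
  replace hP (x) (l : Fin k) : Ideal.Quotient.mk m (P x l) = p x l :=
    congrFun (LinearMap.congr_fun hP x) l
  have hPf (l : Fin k) (u) : (LinearMap.proj l ∘ₗ P ∘ₗ f) u ∈ m := by
    rw [← Ideal.Quotient.eq_zero_iff_mem]
    simp [hP, hpf]
  obtain ⟨p', hp'⟩ := exists_descend_quotient m p
  obtain ⟨f', hf'⟩ := exists_descend_quotient m
    (LinearMap.compLeft (Submodule.mkQ m) (Fin g) ∘ₗ f)
  obtain ⟨ψ, hψ⟩ := exists_descend_quotient m
    (LinearMap.pi fun l => m.toCotangent ∘ₗ LinearMap.codRestrict m _ (hPf l))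
  have ker_le : LinearMap.ker p' ≤ LinearMap.range f' := by
    intro z hz
    obtain ⟨x, rfl⟩ := Function.Surjective.comp_left (α := Fin g) Ideal.Quotient.mk_surjective z
    have hx : x ∈ LinearMap.range f := by
      rw [hexact, LinearMap.mem_ker, ← hp']
      exact hz
    obtain ⟨u, rfl⟩ := hx
    exact ⟨_, hf' u⟩
  have surj : Function.Surjective (ψ ∘ₗ (LinearMap.ker f').subtype) := by
    intro c
    choose y hy using fun l => m.toCotangent_surjective (c l)
    choose s hs using fun i : Fin k => hp (Pi.single i 1)
    have hx : ∑ i, (y i : R) • s i ∈ LinearMap.range f := by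
      rw [hexact, LinearMap.mem_ker, map_sum]
      refine Finset.sum_eq_zero fun i _ => ?_
      ext l
      rw [map_smul, Pi.smul_apply, ← algebraMap_smul (R ⧸ m), Ideal.Quotient.algebraMap_eq,
        Ideal.Quotient.eq_zero_iff_mem.2 (y i).2, zero_smul, Pi.zero_apply]
    obtain ⟨u, hu⟩ := hx
    refine ⟨⟨fun i => Ideal.Quotient.mk m (u i), ?_⟩, ?_⟩
    · rw [LinearMap.mem_ker, hf']
      ext j
      change Ideal.Quotient.mk m (f u j) = 0
      rw [hu, Ideal.Quotient.eq_zero_iff_mem, Finset.sum_apply]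
      exact Ideal.sum_mem _ fun i _ => m.mul_mem_right _ (y i).2
    · refine (hψ u).trans ?_
      ext1 l
      have expand : LinearMap.codRestrict m _ (hPf l) u = ∑ i, P (s i) l • y i := by
        ext
        simp [hu, mul_comm]
      rw [LinearMap.pi_apply, LinearMap.comp_apply, expand, map_sum]
      have coeff (i : Fin k) : m.toCotangent (P (s i) l • y i) = if l = i then c i else 0 := by
        rw [map_smul, hy, ← algebraMap_smul (R ⧸ m), Ideal.Quotient.algebraMap_eq, hP, hs,
          Pi.single_apply]
        split_ifs <;> simp
      simp [coeff]
  have cotangent_le := LinearMap.finrank_le_finrank_of_surjective surj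
  rw [Module.finrank_pi_fintype, Finset.sum_const, Finset.card_univ, Fintype.card_fin,
    smul_eq_mul] at cotangent_le
  have rank_f := f'.finrank_range_add_finrank_ker
  have rank_p := p'.finrank_range_add_finrank_ker
  have range_p := (LinearMap.range p').finrank_le
  have ker_p := Submodule.finrank_mono ker_le
  simp only [Module.finrank_fin_fun] at rank_f rank_p range_p
  omega

/-- Ring homomorphisms out of `ℤ[t, t⁻¹]` are determined by the image of `t`. -/
lemma ringHom_laurent_ext {S : Type*} [CommRing S] {φ ψ : Λ →+* S} (h : φ (T 1) = ψ (T 1)) :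
    φ = ψ := by
  refine IsLocalization.ringHom_ext (Submonoid.powers (Polynomial.X : Polynomial ℤ)) ?_
  refine Polynomial.ringHom_ext (fun n => by simp) ?_
  simpa using h

/-- Evaluation of integral Laurent polynomials at `t = -1`. -/
noncomputable def evalNegOne : Λ →+* ℤ := LaurentPolynomial.eval₂ (RingHom.id ℤ) (-1)

lemma evalNegOne_T : evalNegOne (T 1) = -1 := by
  simp [evalNegOne]

lemma evalNegOne_three : evalNegOne 3 = 3 := map_ofNat evalNegOne 3

lemma three_mem : (3 : Λ) ∈ I := Ideal.subset_span (by simp)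

lemma T_add_one_mem : (T 1 + 1 : Λ) ∈ I := Ideal.subset_span (by simp)

lemma mem_iff_three_dvd_evalNegOne (a : Λ) : a ∈ I ↔ 3 ∣ evalNegOne a := by
  constructor
  · intro ha
    obtain ⟨x, y, rfl⟩ := Ideal.mem_span_pair.1 ha
    simp [evalNegOne_T, evalNegOne_three]
  · rintro ⟨c, hc⟩
    have ht : Ideal.Quotient.mk I (T 1) = -1 := by
      rw [eq_neg_iff_add_eq_zero, ← map_one (Ideal.Quotient.mk I), ← map_add]
      exact Ideal.Quotient.eq_zero_iff_mem.2 T_add_one_mem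
    have mk_eq : Ideal.Quotient.mk I = (Int.castRingHom (Λ ⧸ I)).comp evalNegOne :=
      ringHom_laurent_ext (by simp [evalNegOne_T, ht])
    have h3 : (3 : Λ ⧸ I) = 0 := Ideal.Quotient.eq_zero_iff_mem.2 three_mem
    rw [← Ideal.Quotient.eq_zero_iff_mem, mk_eq]
    simp [hc, h3]

instance isMaximal_I : I.IsMaximal := by
  have : Fact (Nat.Prime 3) := ⟨Nat.prime_three⟩
  have ker_eq : I = RingHom.ker ((Int.castRingHom (ZMod 3)).comp evalNegOne) := by
    ext a
    rw [mem_iff_three_dvd_evalNegOne, RingHom.mem_ker]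
    exact (ZMod.intCast_zmod_eq_zero_iff_dvd _ 3).symm
  rw [ker_eq]
  exact RingHom.ker_isMaximal_of_surjective _ (ZMod.ringHom_surjective _)

/-- The unit `-1 + ε` of the dual numbers over `ZMod 3`. -/
def negOneAddEps : (DualNumber (ZMod 3))ˣ where
  val := -1 + DualNumber.eps
  inv := -1 - DualNumber.eps
  val_inv := by ring_nf; simp [pow_two]
  inv_val := by ring_nf; simp [pow_two]

/-- Evaluation of integral Laurent polynomials at `t = -1 + ε` modulo `3`. -/
noncomputable def evalDual : Λ →+* DualNumber (ZMod 3) :=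
  LaurentPolynomial.eval₂ (Int.castRingHom _) negOneAddEps

lemma evalDual_T : evalDual (T 1) = -1 + DualNumber.eps := by
  simp [evalDual, negOneAddEps]

lemma evalDual_three : evalDual 3 = 0 :=
  (map_ofNat evalDual 3).trans (TrivSqZeroExt.ext rfl rfl)

lemma fst_evalDual (a : Λ) : (evalDual a).fst = (evalNegOne a : ZMod 3) := by
  have : (TrivSqZeroExt.fstHom (ZMod 3) (ZMod 3) (ZMod 3)).toRingHom.comp evalDual
      = (Int.castRingHom (ZMod 3)).comp evalNegOne :=
    ringHom_laurent_ext (by simp [evalDual_T, evalNegOne_T])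
  exact RingHom.congr_fun this a

lemma mem_iff_fst_evalDual (a : Λ) : a ∈ I ↔ (evalDual a).fst = 0 := by
  rw [mem_iff_three_dvd_evalNegOne, fst_evalDual]
  exact (ZMod.intCast_zmod_eq_zero_iff_dvd _ 3).symm

/-- The generators `3` and `t + 1` are independent modulo `⟨3, t+1⟩²`. -/
lemma mem_of_mul_add_mul_mem_sq {a b : Λ} (h : a * 3 + b * (T 1 + 1) ∈ I ^ 2) :
    a ∈ I ∧ b ∈ I := by
  have nine_dvd : I ^ 2 ≤ (Ideal.span {(9 : ℤ)}).comap evalNegOne := by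
    rw [pow_two, Ideal.mul_le]
    intro x hx y hy
    rw [Ideal.mem_comap, Ideal.mem_span_singleton, map_mul]
    exact mul_dvd_mul ((mem_iff_three_dvd_evalNegOne x).1 hx)
      ((mem_iff_three_dvd_evalNegOne y).1 hy)
  have dual_zero : I ^ 2 ≤ RingHom.ker evalDual := by
    rw [pow_two, Ideal.mul_le]
    intro x hx y hy
    rw [mem_iff_fst_evalDual] at hx hy
    rw [RingHom.mem_ker, map_mul]
    ext <;> simp [hx, hy]
  constructor
  · have := Ideal.mem_span_singleton.1 (nine_dvd h)
    rw [mem_iff_three_dvd_evalNegOne]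
    simp [evalNegOne_T, evalNegOne_three] at this
    omega
  · have := congrArg TrivSqZeroExt.snd (RingHom.mem_ker.1 (dual_zero h))
    rw [mem_iff_fst_evalDual]
    simpa [evalDual_T, evalDual_three] using this

instance finite_cotangent_I : Module.Finite (Λ ⧸ I) I.Cotangent := by
  have : Module.Finite Λ I := Module.Finite.iff_fg.2 ⟨{3, T 1 + 1}, by simp⟩
  have : Module.Finite Λ I.Cotangent := Module.Finite.of_surjective _ I.toCotangent_surjective
  exact Module.Finite.of_restrictScalars_finite Λ _ _

lemma two_le_finrank_cotangent_I : 2 ≤ Module.finrank (Λ ⧸ I) I.Cotangent := by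
  let v : Fin 2 → I.Cotangent :=
    ![I.toCotangent ⟨3, three_mem⟩, I.toCotangent ⟨T 1 + 1, T_add_one_mem⟩]
  have independent : LinearIndependent (Λ ⧸ I) v := by
    rw [LinearIndependent.pair_iff]
    intro a b hab
    obtain ⟨a, rfl⟩ := Ideal.Quotient.mk_surjective a
    obtain ⟨b, rfl⟩ := Ideal.Quotient.mk_surjective b
    rw [← Ideal.Quotient.algebraMap_eq, algebraMap_smul, algebraMap_smul, ← map_smul, ← map_smul,
      ← map_add, Ideal.toCotangent_eq_zero] at hab
    simpa [Ideal.Quotient.eq_zero_iff_mem] using mem_of_mul_add_mul_mem_sq hab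
  simpa using independent.fintype_card_le_finrank

/-- For `k ≥ 1`, every exact sequence of `Λ`-modules
`Λ^r → Λ^g → (Λ/⟨3, t+1⟩)^k → 0` satisfies `g − r ≤ −k`: the deficiency of the
`Λ`-module `(Λ/⟨3, t+1⟩)^k` is at most `−k`. -/
theorem deficiency_of_power_le_neg
    (k : ℕ) (hk : 1 ≤ k) (g r : ℕ)
    (f : (Fin r → Λ) →ₗ[Λ] (Fin g → Λ))
    (p : (Fin g → Λ) →ₗ[Λ] (Fin k → Λ ⧸ I))
    (hp : Function.Surjective p)
    (hexact : LinearMap.range f = LinearMap.ker p) :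
    (g : ℤ) - (r : ℤ) ≤ -(k : ℤ) := by
  have bound := add_mul_finrank_cotangent_le I f p hp hexact
  have := Nat.mul_le_mul_left k two_le_finrank_cotangent_I
  omega
end

section
/- Suppose G is a group admitting a finite presentation with g generators and r relations, H is a subgroup of G of finite index n, φ : H → ℤ is a surjective homomorphism with kernel K, and γ ∈ H satisfies φ(γ) = 1. Equip the abelianization K^{ab} of K with the Λ-module structure in which t acts by the automorphism induced by conjugation x ↦ γ x γ⁻¹. Then this Λ-module admits a finite presentation with a generators and b relations satisfying a − b ≥ n(g − r) − n. -/
open LaurentPolynomial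

/-- `GroupPres G g r` means that the group `G` admits a finite presentation with
`g` generators and `r` relations. -/
def GroupPres (G : Type) [Group G] (g r : ℕ) : Prop :=
  ∃ (π : FreeGroup (Fin g) →* G) (R : Finset (FreeGroup (Fin g))),
    Function.Surjective π ∧ R.card = r ∧
      Subgroup.normalClosure (R : Set (FreeGroup (Fin g))) = MonoidHom.ker π

/-- `ModPres M a b` means that the `Λ`-module `M` admits a finite presentation
with `a` generators and `b` relations: an exact sequence `Λ^b → Λ^a → M → 0`. -/
def ModPres (M : Type) [AddCommGroup M] [Module Λ M] (a b : ℕ) : Prop :=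
  ∃ (f : (Fin b → Λ) →ₗ[Λ] (Fin a → Λ)) (p : (Fin a → Λ) →ₗ[Λ] M),
    Function.Surjective p ∧ LinearMap.range f = LinearMap.ker p

/-- `d` is a crossed homomorphism to a `Λ`-module on which `a` acts as `t ^ φ a`. -/
def IsCrossedHom {H N : Type} [Group H] [AddCommGroup N] [Module Λ N]
    (φ : H →* Multiplicative ℤ) (d : H → N) : Prop :=
  ∀ a b, d (a * b) = d a + (T (φ a).toAdd : Λ) • d b

namespace IsCrossedHom

variable {H N : Type} [Group H] [AddCommGroup N] [Module Λ N]
  {φ : H →* Multiplicative ℤ} {d : H → N}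

theorem map_one (hd : IsCrossedHom φ d) : d 1 = 0 := by
  simpa using hd 1 1

theorem map_inv_eq_zero (hd : IsCrossedHom φ d) {a : H} (ha : d a = 0) : d a⁻¹ = 0 := by
  have h := hd a⁻¹ a
  rwa [inv_mul_cancel, hd.map_one, ha, smul_zero, add_zero, eq_comm] at h

theorem map_zpow_eq_zero (hd : IsCrossedHom φ d) {a : H} (ha : d a = 0) (k : ℤ) :
    d (a ^ k) = 0 := by
  induction k using Int.induction_on with
  | zero => simpa using hd.map_one
  | succ k ih => rw [zpow_add_one, hd, ih, ha, smul_zero, add_zero]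
  | pred k ih => rw [zpow_sub_one, hd, ih, hd.map_inv_eq_zero ha, smul_zero, add_zero]

end IsCrossedHom

theorem T_add_smul {N : Type} [AddCommGroup N] [Module Λ N] (j k : ℤ) (m : N) :
    (T (j + k) : Λ) • m = (T j : Λ) • (T k : Λ) • m := by
  rw [T_add, mul_smul]

/-- An additive map commuting with multiplication by `t` is `Λ`-linear. -/
def AddMonoidHom.toLaurentLinearMap {M N : Type} [AddCommGroup M] [Module Λ M] [AddCommGroup N]
    [Module Λ N] (q : M →+ N) (hq : ∀ m, q ((T 1 : Λ) • m) = (T 1 : Λ) • q m) : M →ₗ[Λ] N where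
  toFun := q
  map_add' := q.map_add
  map_smul' := by
    have hT_neg (m : M) : q ((T (-1) : Λ) • m) = (T (-1) : Λ) • q m := by
      have h := hq ((T (-1) : Λ) • m)
      rw [← T_add_smul, add_neg_cancel, T_zero, one_smul] at h
      rw [h, ← T_add_smul, neg_add_cancel, T_zero, one_smul]
    have hT (k : ℤ) : ∀ m, q ((T k : Λ) • m) = (T k : Λ) • q m := by
      induction k using Int.induction_on with
      | zero => simp
      | succ k ih => intro m; rw [T_add_smul, ih, hq, T_add_smul]
      | pred k ih => intro m; rw [sub_eq_add_neg, T_add_smul, ih, hT_neg, T_add_smul]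
    intro f m
    induction f using LaurentPolynomial.induction_on' with
    | add f g hf hg =>
      rw [RingHom.id_apply] at hf hg ⊢
      rw [add_smul, q.map_add, hf, hg, add_smul]
    | C_mul_T k a =>
      have hC : (C a : Λ) = (a : Λ) := by simp
      rw [RingHom.id_apply, mul_smul, mul_smul, hC, Int.cast_smul_eq_zsmul, map_zsmul, hT,
        Int.cast_smul_eq_zsmul]

/-- The abelianization of `ker φ` is the universal `Λ`-module receiving a crossed homomorphism
that vanishes at `γ`. -/
theorem exists_universal_crossedHom {H : Type} [Group H] (φ : H →* Multiplicative ℤ)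
    (γ : H) (hγ : φ γ = Multiplicative.ofAdd 1) (M : Type) [AddCommGroup M] [Module Λ M]
    (e : Additive (Abelianization (MonoidHom.ker φ)) ≃+ M)
    (ht : ∀ x y : MonoidHom.ker φ, (y : H) = γ * (x : H) * γ⁻¹ →
      (T 1 : Λ) • e (Additive.ofMul (Abelianization.of x)) =
        e (Additive.ofMul (Abelianization.of y))) :
    ∃ D : H → M, IsCrossedHom φ D ∧ D γ = 0 ∧ Function.Surjective D ∧
      ∀ (N : Type) [AddCommGroup N] [Module Λ N] (d : H → N), IsCrossedHom φ d → d γ = 0 →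
        ∃ q : M →ₗ[Λ] N, ∀ h, q (D h) = d h := by
  let c : MonoidHom.ker φ → M := fun k => e (Additive.ofMul (Abelianization.of k))
  have c_mul (k l) : c (k * l) = c k + c l := by simp [c]
  have c_surj (m : M) : ∃ k, c k = m := by
    obtain ⟨k, hk⟩ := QuotientGroup.mk_surjective (e.symm m).toMul
    exact ⟨k, e.symm.injective ((e.symm_apply_apply _).trans hk)⟩
  have hconj (j : ℤ) (k : MonoidHom.ker φ) : γ ^ j * (k : H) * γ ^ (-j) ∈ MonoidHom.ker φ := by
    have h : φ (k : H) = 1 := k.2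
    rw [MonoidHom.mem_ker]
    simp [h]
  have c_conj (j : ℤ) (k : MonoidHom.ker φ) :
      (T j : Λ) • c k = c ⟨γ ^ j * (k : H) * γ ^ (-j), hconj j k⟩ := by
    induction j using Int.induction_on with
    | zero => simp
    | succ j ih =>
      rw [add_comm, T_add_smul, ih]
      apply ht
      simp only [zpow_add, neg_add, zpow_neg, zpow_one]
      group
    | pred j ih =>
      have h : (T 1 : Λ) • c ⟨_, hconj (-j - 1) k⟩ = c ⟨_, hconj (-j) k⟩ := by
        apply ht
        group
      calc (T (-j - 1) : Λ) • c k = (T (-1) : Λ) • (T (-j) : Λ) • c k := by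
            rw [← T_add_smul, sub_eq_neg_add]
        _ = _ := by rw [ih, ← h, ← T_add_smul, neg_add_cancel, T_zero, one_smul]
  have hker (h : H) : h * γ ^ (-(φ h).toAdd) ∈ MonoidHom.ker φ := by
    rw [MonoidHom.mem_ker, map_mul, map_zpow, hγ, ← ofAdd_zsmul]
    apply Multiplicative.toAdd.injective
    simp
  have D_eq (h : H) (k : MonoidHom.ker φ) (hk : h * γ ^ (-(φ h).toAdd) = k) :
      c ⟨h * γ ^ (-(φ h).toAdd), hker h⟩ = c k := congrArg c (Subtype.ext hk)
  have D_coe (k : MonoidHom.ker φ) : c ⟨(k : H) * γ ^ (-(φ k).toAdd), hker k⟩ = c k := by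
    have h : φ (k : H) = 1 := k.2
    exact D_eq _ _ (by simp [h])
  refine ⟨fun h => c ⟨h * γ ^ (-(φ h).toAdd), hker h⟩, ?_, ?_, ?_, ?_⟩
  · intro a b
    rw [c_conj, ← c_mul]
    apply D_eq
    simp only [Subgroup.coe_mul, map_mul, toAdd_mul]
    group
  · have c_one : c 1 = 0 := by simp [c]
    rw [← c_one]
    apply D_eq
    simp [hγ]
  · intro m
    obtain ⟨k, rfl⟩ := c_surj m
    exact ⟨k, D_coe k⟩
  · intro N _ _ d hd hdγ
    let f : MonoidHom.ker φ →* Multiplicative N :=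
      { toFun k := Multiplicative.ofAdd (d k)
        map_one' := by simp [hd.map_one]
        map_mul' k l := by
          have h : φ (k : H) = 1 := k.2
          simp [hd (k : H) l, h] }
    let q₀ : M →+ N := (MonoidHom.toAdditiveLeft (Abelianization.lift f)).comp e.symm
    have hq₀ (k) : q₀ (c k) = d k := by simp [q₀, c, f]
    have hq₀T (m : M) : q₀ ((T 1 : Λ) • m) = (T 1 : Λ) • q₀ m := by
      obtain ⟨k, rfl⟩ := c_surj m
      have h : φ (k : H) = 1 := k.2
      have hkγ : γ * (k : H) * γ⁻¹ ∈ MonoidHom.ker φ := by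
        rw [MonoidHom.mem_ker]
        simp [h]
      rw [ht k ⟨_, hkγ⟩ rfl]
      refine (hq₀ _).trans ?_
      rw [hq₀, hd, hd, hdγ, hd.map_inv_eq_zero hdγ, hγ]
      simp
    refine ⟨q₀.toLaurentLinearMap hq₀T, fun h => (hq₀ _).trans ?_⟩
    change d (h * _) = d h
    rw [hd, hd.map_zpow_eq_zero hdγ, smul_zero, add_zero]

/-- Generators and relations indexed by arbitrary finite types. -/
theorem ModPres.of_span_eq_ker {M ι κ : Type} [AddCommGroup M] [Module Λ M] [Fintype ι]
    [Fintype κ] (rel : κ → ι → Λ) (p : (ι → Λ) →ₗ[Λ] M) (hp : Function.Surjective p)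
    (hrel : Submodule.span Λ (Set.range rel) = LinearMap.ker p) :
    ModPres M (Fintype.card ι) (Fintype.card κ) := by
  let u : (Fin (Fintype.card ι) → Λ) ≃ₗ[Λ] (ι → Λ) :=
    LinearEquiv.funCongrLeft Λ Λ (Fintype.equivFin ι)
  let v : (Fin (Fintype.card κ) → Λ) ≃ₗ[Λ] (κ → Λ) :=
    LinearEquiv.funCongrLeft Λ Λ (Fintype.equivFin κ)
  refine ⟨u.symm.toLinearMap ∘ₗ Fintype.linearCombination Λ rel ∘ₗ v.toLinearMap,
    p ∘ₗ u.toLinearMap, hp.comp u.surjective, ?_⟩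
  rw [LinearMap.range_comp, LinearMap.range_comp_of_range_eq_top _ v.range,
    Fintype.range_linearCombination, hrel, LinearMap.ker_comp]
  exact Submodule.map_equiv_eq_comap_symm u.symm _

section Transversal

variable {G : Type} [Group G] {H : Subgroup G} {s : G ⧸ H → G}

/-- The element of `H` by which `g` moves the representative of `x` to that of `g • x`. -/
def transversalCocycle (hs : ∀ x, (s x : G ⧸ H) = x) (g : G) (x : G ⧸ H) : H :=
  ⟨(s (g • x))⁻¹ * (g * s x), by
    rw [← QuotientGroup.eq, hs]
    conv_lhs => rw [← hs x]
    rfl⟩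

variable (hs : ∀ x, (s x : G ⧸ H) = x)

theorem transversalCocycle_mul (a b : G) (x : G ⧸ H) :
    transversalCocycle hs (a * b) x =
      transversalCocycle hs a (b • x) * transversalCocycle hs b x := by
  ext
  simp only [transversalCocycle, Subgroup.coe_mul, mul_smul]
  group

theorem transversalCocycle_one (x : G ⧸ H) : transversalCocycle hs 1 x = 1 := by
  ext
  simp [transversalCocycle]

theorem coe_smul_base (h : H) : (h : G) • ((1 : G) : G ⧸ H) = ((1 : G) : G ⧸ H) := by
  change ((h * 1 : G) : G ⧸ H) = _
  rw [QuotientGroup.eq]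
  simp

theorem rep_smul_base (hs : ∀ x, (s x : G ⧸ H) = x) (x : G ⧸ H) :
    s x • ((1 : G) : G ⧸ H) = x := by
  change ((s x * 1 : G) : G ⧸ H) = _
  rw [mul_one, hs]

theorem transversalCocycle_coe_base (hs1 : s (1 : G) = 1) (h : H) :
    transversalCocycle hs (h : G) (1 : G) = h := by
  ext
  simp only [transversalCocycle, coe_smul_base, hs1, inv_one, one_mul, mul_one]

theorem transversalCocycle_rep_base (hs1 : s (1 : G) = 1) (x : G ⧸ H) :
    transversalCocycle hs (s x) (1 : G) = 1 := by
  ext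
  simp only [transversalCocycle, rep_smul_base hs, hs1, mul_one, inv_mul_cancel, Subgroup.coe_one]

end Transversal

section AffineAction

variable {G X ι : Type} [Group G] [MulAction G X] {N : Type} [AddCommGroup N] [Module Λ N]

/-- The fibrewise affine permutation of `X × N` over the action of `g` on `X`, with translation
part `v` and linear part `t ^ τ`. -/
noncomputable def affinePerm (g : G) (τ : X → ℤ) (v : X → N) : Equiv.Perm (X × N) where
  toFun y := (g • y.1, v y.1 + (T (τ y.1) : Λ) • y.2)
  invFun y := (g⁻¹ • y.1, (T (-τ (g⁻¹ • y.1)) : Λ) • (y.2 - v (g⁻¹ • y.1)))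
  left_inv y := by
    ext1
    · simp
    · simp [← T_add_smul]
  right_inv y := by
    ext1
    · simp
    · simp [← T_add_smul]

/-- The action of the free group on `X × N` in which the generator `i` acts over `π i` with
translation part `v i`. -/
noncomputable def affineAction (π : FreeGroup ι →* G) (τ : G → X → ℤ) (v : ι → X → N) :
    FreeGroup ι →* Equiv.Perm (X × N) :=
  FreeGroup.lift fun i => affinePerm (π (FreeGroup.of i)) (τ (π (FreeGroup.of i))) (v i)

variable {π : FreeGroup ι →* G} {τ : G → X → ℤ} {v : ι → X → N}

theorem affineAction_of (i : ι) (x : X) (m : N) :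
    affineAction π τ v (FreeGroup.of i) (x, m) =
      (π (FreeGroup.of i) • x, v i x + (T (τ (π (FreeGroup.of i)) x) : Λ) • m) := by
  simp [affineAction, affinePerm]

/-- A map from a permutation representation of a free group to another action is equivariant as
soon as it commutes with the generators. -/
theorem freeGroup_equivariant_of_generators {Y Z : Type} (A : FreeGroup ι →* Equiv.Perm Y)
    (f : FreeGroup ι → Z → Z) (hf1 : ∀ z, f 1 z = z)
    (hfm : ∀ a b z, f (a * b) z = f a (f b z)) (q : Y → Z)
    (h : ∀ i y, q (A (FreeGroup.of i) y) = f (FreeGroup.of i) (q y)) (w : FreeGroup ι) (y : Y) :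
    q (A w y) = f w (q y) := by
  induction w using FreeGroup.induction_on generalizing y with
  | C1 => simp [hf1]
  | of i => exact h i y
  | inv_of i _ =>
    have := h i (A (FreeGroup.of i)⁻¹ y)
    rw [← Equiv.Perm.mul_apply, ← map_mul, mul_inv_cancel, map_one, Equiv.Perm.one_apply] at this
    rw [this, ← hfm, inv_mul_cancel, hf1]
  | mul a b ha hb => rw [map_mul, Equiv.Perm.mul_apply, ha, hb, hfm]

/-- The action is determined by its values on the zero section. -/
theorem affineAction_apply (hτ : ∀ a b x, τ (a * b) x = τ a (b • x) + τ b x)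
    (w : FreeGroup ι) (x : X) (m : N) :
    affineAction π τ v w (x, m) =
      (π w • x, (affineAction π τ v w (x, 0)).2 + (T (τ (π w) x) : Λ) • m) := by
  have hτ1 (x : X) : τ 1 x = 0 := by simpa using hτ 1 1 x
  suffices ∃ c : X → N, ∀ x m,
      affineAction π τ v w (x, m) = (π w • x, c x + (T (τ (π w) x) : Λ) • m) by
    obtain ⟨c, hc⟩ := this
    simp [hc]
  induction w using FreeGroup.induction_on with
  | C1 => exact ⟨0, fun x m => by simp [hτ1]⟩
  | of i => exact ⟨v i, affineAction_of i⟩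
  | inv_of i ih =>
    obtain ⟨c, hc⟩ := ih
    refine ⟨fun x => -((T (τ (π (FreeGroup.of i)⁻¹) x) : Λ) • c (π (FreeGroup.of i)⁻¹ • x)),
      fun x m => ?_⟩
    rw [map_inv, Equiv.Perm.inv_eq_iff_eq, hc]
    have h := hτ (π (FreeGroup.of i)) (π (FreeGroup.of i))⁻¹ x
    rw [mul_inv_cancel, hτ1] at h
    ext1
    · simp
    · simp [← T_add_smul, ← h]
  | mul a b ha hb =>
    obtain ⟨c, hc⟩ := ha
    obtain ⟨c', hc'⟩ := hb
    refine ⟨fun x => c (π b • x) + (T (τ (π a) (π b • x)) : Λ) • c' x, fun x m => ?_⟩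
    rw [map_mul, Equiv.Perm.mul_apply, hc', hc, map_mul, hτ, T_add_smul]
    simp [mul_smul, add_assoc]

end AffineAction


/-- Suppose `G` has a finite presentation with `g` generators and `r` relations,
`H ≤ G` has finite index `n`, `φ : H → ℤ` is surjective with kernel `K`, and
`γ ∈ H` has `φ(γ) = 1`.  Then the abelianization of `K`, as a `Λ`-module with
`t` acting by the automorphism induced by conjugation by `γ`, admits a finite
presentation with `a` generators and `b` relations with `a − b ≥ n(g − r) − n`. -/
theorem modPres_abelianization_iterated_cover
    (G : Type) [Group G] (g r n : ℕ) (hn : 0 < n)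
    (hG : GroupPres G g r) (H : Subgroup G) (hH : H.index = n)
    (φ : H →* Multiplicative ℤ) (hφ : Function.Surjective φ)
    (γ : H) (hγ : φ γ = Multiplicative.ofAdd 1)
    (M : Type) [AddCommGroup M] [Module Λ M]
    (e : Additive (Abelianization (MonoidHom.ker φ)) ≃+ M)
    (ht : ∀ x : MonoidHom.ker φ,
      (T 1 : Λ) • e (Additive.ofMul (Abelianization.of x)) =
        e (Additive.ofMul (Abelianization.of
          (⟨γ * (x : H) * γ⁻¹, by
            have h : φ (x : H) = 1 := x.2
            simp [MonoidHom.mem_ker, h]⟩ : MonoidHom.ker φ)))) :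
    ∃ a b : ℕ, ModPres M a b ∧
      (n : ℤ) * ((g : ℤ) - (r : ℤ)) - (n : ℤ) ≤ (a : ℤ) - (b : ℤ) := by
  classical
  obtain ⟨π, R, hπ, hR, hker⟩ := hG
  obtain ⟨D, hD, hDγ, hDsurj, hDuniv⟩ := exists_universal_crossedHom φ γ hγ M e
    fun x y hy => (ht x).trans (by congr 4; exact hy.symm)
  have : H.FiniteIndex := ⟨by omega⟩
  let : Fintype (G ⧸ H) := H.fintypeQuotientOfFiniteIndex
  obtain ⟨s, hs, hs1⟩ : ∃ s : G ⧸ H → G, (∀ x, (s x : G ⧸ H) = x) ∧ s (1 : G) = 1 := by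
    refine ⟨Function.update Quotient.out ((1 : G) : G ⧸ H) 1, fun x => ?_, by simp⟩
    by_cases hx : x = ((1 : G) : G ⧸ H)
    · simp [hx]
    · simp [hx]
  let x₀ : G ⧸ H := ((1 : G) : G ⧸ H)
  let τ : G → G ⧸ H → ℤ := fun a x => (φ (transversalCocycle hs a x)).toAdd
  have hτ (a b x) : τ (a * b) x = τ a (b • x) + τ b x := by simp [τ, transversalCocycle_mul]
  have hτ1 (x) : τ 1 x = 0 := by simp [τ, transversalCocycle_one]
  obtain ⟨u, hu⟩ : ∃ u : G ⧸ H → FreeGroup (Fin g),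
      ∀ x, π (u x) = if x = x₀ then (γ : G) else s x :=
    ⟨fun x => (hπ _).choose, fun x => (hπ _).choose_spec⟩
  let v : Fin g → G ⧸ H → (G ⧸ H) × Fin g → Λ := fun i x => Pi.single (x, i) 1
  let A := affineAction π τ v
  let rel : (R × (G ⧸ H)) ⊕ (G ⧸ H) → (G ⧸ H) × Fin g → Λ :=
    Sum.elim (fun y => (A y.1 (y.2, 0)).2) (fun x => (A (u x) (x₀, 0)).2)
  let S := Submodule.span Λ (Set.range rel)
  let p : ((G ⧸ H) × Fin g → Λ) →ₗ[Λ] M := Fintype.linearCombination Λ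
    fun y => D (transversalCocycle hs (π (FreeGroup.of y.2)) y.1)
  have hpv (i x) : p (v i x) = D (transversalCocycle hs (π (FreeGroup.of i)) x) := by
    simp [p, v]
  have hpA (w x) : p (A w (x, 0)).2 = D (transversalCocycle hs (π w) x) := by
    have h := freeGroup_equivariant_of_generators A
      (fun w z => (π w • z.1, D (transversalCocycle hs (π w) z.1) + (T (τ (π w) z.1) : Λ) • z.2))
      (fun z => by simp [transversalCocycle_one, hD.map_one, hτ1])
      (fun a b z => by
        ext1
        · simp [mul_smul]
        · simp [transversalCocycle_mul, hD _ _, hτ, T_add_smul, add_assoc, τ])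
      (Prod.map id p) (fun i ⟨x, m⟩ => by simp [A, affineAction_of, hpv]) w (x, 0)
    simpa using congrArg Prod.snd h
  have hsurj : Function.Surjective p := fun m => by
    obtain ⟨h, rfl⟩ := hDsurj m
    obtain ⟨w, hw⟩ := hπ h
    exact ⟨_, by rw [hpA w x₀, hw, transversalCocycle_coe_base hs hs1]⟩
  have hSp : S ≤ LinearMap.ker p := by
    rw [Submodule.span_le]
    rintro _ ⟨⟨ρ, x⟩ | x, rfl⟩
    · have hρ : π ρ = 1 := by
        rw [← MonoidHom.mem_ker, ← hker]
        exact Subgroup.subset_normalClosure ρ.2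
      simp [rel, hpA, hρ, transversalCocycle_one, hD.map_one]
    · by_cases hx : x = x₀
      · simp [rel, hpA, hu, hx, x₀, transversalCocycle_coe_base hs hs1, hDγ]
      · simp [rel, hpA, hu, hx, x₀, transversalCocycle_rep_base hs hs1, hD.map_one]
  let A' := affineAction π τ fun i x => S.mkQ (v i x)
  have hA' (w x) : S.mkQ (A w (x, 0)).2 = (A' w (x, 0)).2 := by
    have h := freeGroup_equivariant_of_generators A (fun w => A' w) (by simp) (by simp)
      (Prod.map id S.mkQ) (fun i ⟨x, m⟩ => by simp [A, A', affineAction_of]) w (x, 0)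
    simpa using congrArg Prod.snd h
  have hA'R : MonoidHom.ker π ≤ MonoidHom.ker A' := by
    rw [← hker]
    refine Subgroup.normalClosure_le_normal fun ρ hρ => ?_
    have hπρ : π ρ = 1 := by
      rw [← MonoidHom.mem_ker, ← hker]
      exact Subgroup.subset_normalClosure hρ
    refine Equiv.ext fun ⟨x, m⟩ => ?_
    have h0 : (A' ρ (x, 0)).2 = 0 := by
      rw [← hA', Submodule.mkQ_apply, Submodule.Quotient.mk_eq_zero]
      exact Submodule.subset_span ⟨.inl (⟨ρ, hρ⟩, x), rfl⟩
    have h : A' ρ (x, m) = (π ρ • x, (A' ρ (x, 0)).2 + (T (τ (π ρ) x) : Λ) • m) :=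
      affineAction_apply hτ ρ x m
    rw [h, h0, hπρ, hτ1]
    simp
  obtain ⟨B, hBA⟩ : ∃ B : G →* Equiv.Perm ((G ⧸ H) × (_ ⧸ S)), ∀ w, B (π w) = A' w :=
    ⟨π.liftOfSurjective hπ ⟨A', hA'R⟩, π.liftOfRightInverse_comp_apply _ _ ⟨A', hA'R⟩⟩
  have hB (a x m) : B a (x, m) = (a • x, (B a (x, 0)).2 + (T (τ a x) : Λ) • m) := by
    obtain ⟨w, rfl⟩ := hπ a
    rw [hBA]
    exact affineAction_apply hτ w x m
  have hBu (x) : (B (if x = x₀ then (γ : G) else s x) (x₀, 0)).2 = 0 := by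
    rw [← hu, hBA, ← hA', Submodule.mkQ_apply, Submodule.Quotient.mk_eq_zero]
    exact Submodule.subset_span ⟨.inr x, rfl⟩
  have hBs (x m) : B (s x) (x₀, m) = (x, m) := by
    by_cases hx : x = x₀
    · simp [hx, x₀, hs1]
    · have h := hBu x
      rw [if_neg hx] at h
      rw [hB, h, rep_smul_base hs]
      simp [τ, x₀, transversalCocycle_rep_base hs hs1]
  let d : H → _ ⧸ S := fun h => (B h (x₀, 0)).2
  have hBd (h : H) (m) : B h (x₀, m) = (x₀, d h + (T (φ h).toAdd : Λ) • m) := by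
    rw [hB, coe_smul_base]
    simp [τ, x₀, d, transversalCocycle_coe_base hs hs1]
  have hd : IsCrossedHom φ d := fun a b => by
    change (B ((a : G) * b) (x₀, 0)).2 = _
    rw [map_mul, Equiv.Perm.mul_apply, hBd b, hBd a]
    simp
  have hdγ : d γ = 0 := by simpa using hBu x₀
  have hdB (a x) : d (transversalCocycle hs a x) = (B a (x, 0)).2 := by
    change (B ((s (a • x))⁻¹ * (a * s x)) (x₀, 0)).2 = _
    rw [map_mul, map_mul, map_inv, Equiv.Perm.mul_apply, Equiv.Perm.mul_apply, hBs, hB a,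
      Equiv.Perm.inv_eq_iff_eq.2 (hBs _ _).symm]
  obtain ⟨q, hq⟩ := hDuniv _ d hd hdγ
  have hqp : q ∘ₗ p = S.mkQ := by
    refine LinearMap.pi_ext' fun y => LinearMap.ext_ring ?_
    change q (p (v y.2 y.1)) = S.mkQ (v y.2 y.1)
    rw [hpv, hq, hdB, hBA]
    simp [A', affineAction_of]
  have hpS : LinearMap.ker p ≤ S := by
    rw [← S.ker_mkQ, ← hqp]
    exact LinearMap.ker_le_ker_comp p q
  refine ⟨_, _, ModPres.of_span_eq_ker rel p hsurj (le_antisymm hSp hpS), ?_⟩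
  have hcard : Fintype.card (G ⧸ H) = n := by
    rw [← hH, Subgroup.index, Nat.card_eq_fintype_card]
  simp only [Fintype.card_sum, Fintype.card_prod, Fintype.card_fin, Fintype.card_coe, hcard, hR]
  push_cast
  linarith
end
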